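/- Let G be a finite simple graph with mad(G) < 18/7 and ch_3^d(G) > 6 such that every proper subgraph H of G (obtained from G by deleting at least one vertex or at least one edge) satisfies ch_3^d(H) ≤ 6. Then there is no vertex x of degree 3 that simultaneously has a neighbor in W_1(G), a neighbor in W_2(G), and a weak neighbor in W_3(G). -/

import Mathlib

open SimpleGraph

/-- `φ` is a proper coloring of `G` that is 3-dynamic: every vertex `v` sees at least
`min 3 (deg v)` distinct colors on its neighborhood. -/
def IsDyn3Coloring {V : Type*} (G : SimpleGraph V) (φ : V → ℕ) : Prop :=
  (∀ u v, G.Adj u v → φ u ≠ φ v) ∧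
  ∀ v, min 3 (G.neighborSet v).ncard ≤ (φ '' G.neighborSet v).ncard

/-- `G` is 3-dynamically colorable from the list assignment `L`. -/
def Dyn3ListColorable {V : Type*} (G : SimpleGraph V) (L : V → Finset ℕ) : Prop :=
  ∃ φ : V → ℕ, IsDyn3Coloring G φ ∧ ∀ v, φ v ∈ L v

/-- `ch_3^d(G) ≤ k` : `G` is 3-dynamically `L`-colorable for every list assignment `L`
with `|L v| ≥ k` for all `v`. -/
def Ch3dLE {V : Type*} (G : SimpleGraph V) (k : ℕ) : Prop :=
  ∀ L : V → Finset ℕ, (∀ v, k ≤ (L v).card) → Dyn3ListColorable G L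

/-- `mad(G) < c` : every nonempty subgraph has average degree `< c`. -/
def MadLT {V : Type*} (G : SimpleGraph V) (c : ℚ) : Prop :=
  ∀ H : G.Subgraph, H.verts.Nonempty →
    (2 * H.edgeSet.ncard : ℚ) / (H.verts.ncard : ℚ) < c

/-- `mad(G) ≤ c` : every nonempty subgraph has average degree `≤ c`. -/
def MadLE {V : Type*} (G : SimpleGraph V) (c : ℚ) : Prop :=
  ∀ H : G.Subgraph, H.verts.Nonempty →
    (2 * H.edgeSet.ncard : ℚ) / (H.verts.ncard : ℚ) ≤ c

/-- Every proper subgraph of `G` (deleting at least one vertex or edge) has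
`ch_3^d ≤ k`. -/
def ProperSubgraphsCh3dLE {V : Type*} (G : SimpleGraph V) (k : ℕ) : Prop :=
  ∀ H : G.Subgraph, H ≠ ⊤ → Ch3dLE H.coe k

/-- `x ∈ W_i(G)` : `x` has degree 3 and exactly `i` neighbors of degree 2. -/
def Wmem {V : Type*} (G : SimpleGraph V) (i : ℕ) (x : V) : Prop :=
  (G.neighborSet x).ncard = 3 ∧
    {y | G.Adj x y ∧ (G.neighborSet y).ncard = 2}.ncard = i

/-- `y` is a weak neighbor of `x` : they are distinct and have a common neighbor of
degree 2. -/
def WeakAdj {V : Type*} (G : SimpleGraph V) (x y : V) : Prop :=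
  x ≠ y ∧ ∃ w, G.Adj x w ∧ G.Adj y w ∧ (G.neighborSet w).ncard = 2


lemma ex_ne1 {X : Finset ℕ} (h : 2 ≤ X.card) (a : ℕ) : ∃ c ∈ X, c ≠ a := by
  have : (X \ {a}).Nonempty := by
    rw [← Finset.card_pos]
    have := Finset.le_card_sdiff {a} X
    simp at this; omega
  obtain ⟨c, hc⟩ := this
  simp at hc
  exact ⟨c, hc.1, hc.2⟩

lemma ex_ne2 {X : Finset ℕ} (h : 3 ≤ X.card) (a b : ℕ) : ∃ c ∈ X, c ≠ a ∧ c ≠ b := by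
  have : (X \ {a, b}).Nonempty := by
    rw [← Finset.card_pos]
    have := Finset.le_card_sdiff {a, b} X
    have := Finset.card_le_two (a := a) (b := b)
    omega
  obtain ⟨c, hc⟩ := this
  simp at hc
  exact ⟨c, hc.1, hc.2⟩

lemma sdr4 {X Z A B : Finset ℕ} (hX : 3 ≤ X.card) (hZ : 3 ≤ Z.card) (hA : 3 ≤ A.card)
    (hB : 3 ≤ B.card) {p q r s : ℕ} (hp : p ∈ X) (hq : q ∈ Z) (hr : r ∈ A) (hs : s ∈ B)
    (h1 : p ≠ q) (h2 : p ≠ r) (h3 : p ≠ s) (h4 : q ≠ r) (h5 : q ≠ s) (h6 : r ≠ s) :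
    ∃ p' ∈ X, ∃ q' ∈ Z, ∃ r' ∈ A, ∃ s' ∈ B, p' ≠ q' ∧ p' ≠ r' ∧ p' ≠ s' ∧ q' ≠ r' ∧ q' ≠ s' ∧
      r' ≠ s' ∧ (p' ≠ p ∨ q' ≠ q) := by
  obtain ⟨q', hq', hq1, hq2⟩ := ex_ne2 hZ q p
  obtain ⟨p', hp', hp1, hp2⟩ := ex_ne2 hX p q
  by_cases pA : p ∈ A
  · by_cases pB : p ∈ B
    · by_cases qA : q ∈ A
      · by_cases qB : q ∈ B
        · by_cases e : q' = r
          · exact ⟨p, hp, q', hq', q, qA, s, hs, by grind⟩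
          · exact ⟨p, hp, q', hq', r, hr, q, qB, by grind⟩
        · obtain ⟨r', hr', _, _⟩ := ex_ne2 hA p' q
          obtain ⟨s', hs', _, _⟩ := ex_ne2 hB p' r'
          exact ⟨p', hp', q, hq, r', hr', s', hs', by grind⟩
      · obtain ⟨s', hs', _, _⟩ := ex_ne2 hB p' q
        obtain ⟨r', hr', _, _⟩ := ex_ne2 hA p' s'
        exact ⟨p', hp', q, hq, r', hr', s', hs', by grind⟩
    · obtain ⟨r', hr', _, _⟩ := ex_ne2 hA q' p
      obtain ⟨s', hs', _, _⟩ := ex_ne2 hB q' r'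
      exact ⟨p, hp, q', hq', r', hr', s', hs', by grind⟩
  · obtain ⟨s', hs', _, _⟩ := ex_ne2 hB q' p
    obtain ⟨r', hr', _, _⟩ := ex_ne2 hA q' s'
    exact ⟨p, hp, q', hq', r', hr', s', hs', by grind⟩

lemma sdr3 {Z A B : Finset ℕ} (hZ : 2 ≤ Z.card) (hA : 2 ≤ A.card)
    (hB : 3 ≤ B.card) (q : ℕ) :
    ∃ q' ∈ Z, ∃ r' ∈ A, ∃ s' ∈ B, q' ≠ r' ∧ q' ≠ s' ∧ r' ≠ s' ∧ q' ≠ q := by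
  obtain ⟨q', hq', hq1⟩ := ex_ne1 hZ q
  obtain ⟨r', hr', hr1⟩ := ex_ne1 hA q'
  obtain ⟨s', hs', _, _⟩ := ex_ne2 hB q' r'
  exact ⟨q', hq', r', hr', s', hs', by grind⟩

def POff {V : Type*} [DecidableEq V] (CN : V → Finset V) (L : V → Finset ℕ) (U : Finset V)
    (φ : V → ℕ) : Prop :=
  (∀ a, a ∉ U → φ a ∈ L a) ∧ ∀ a, a ∉ U → ∀ b, b ∉ U → b ∈ CN a → φ a ≠ φ b

def avl {V : Type*} [DecidableEq V] (CN : V → Finset V) (L : V → Finset ℕ) (U : Finset V)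
    (φ : V → ℕ) (s : V) : Finset ℕ := L s \ ((CN s \ U).image φ)

lemma POff.mono {V : Type*} [DecidableEq V] {CN : V → Finset V} {L : V → Finset ℕ}
    {U U' : Finset V} {φ : V → ℕ} (h : POff CN L U φ) (hU : U ⊆ U') : POff CN L U' φ :=
  ⟨fun a ha => h.1 a (fun h' => ha (hU h')),
    fun a ha b hb => h.2 a (fun h' => ha (hU h')) b (fun h' => hb (hU h'))⟩

lemma POff.mem_avl {V : Type*} [DecidableEq V] {CN : V → Finset V} {L : V → Finset ℕ}
    {U U' : Finset V} {φ : V → ℕ} (h : POff CN L U φ) (hU : U ⊆ U') {s : V} (hs : s ∉ U) :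
    φ s ∈ avl CN L U' φ s := by
  simp only [avl, Finset.mem_sdiff, Finset.mem_image, not_exists, not_and]
  refine ⟨h.1 s hs, fun b hb e => ?_⟩
  exact h.2 s hs b (fun h' => hb.2 (hU h')) hb.1 e.symm

lemma POff.glue {V : Type*} [DecidableEq V] {CN : V → Finset V} {L : V → Finset ℕ}
    {U S : Finset V} {φ f : V → ℕ} (h : POff CN L U φ)
    (hsymm : ∀ a b, b ∈ CN a → a ∈ CN b) (hirr : ∀ a, a ∉ CN a)
    (hf : ∀ s ∈ S, f s ∈ avl CN L U φ s) (hinj : ∀ s ∈ S, ∀ t ∈ S, s ≠ t → f s ≠ f t) :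
    POff CN L (U \ S) (fun v => if v ∈ S then f v else φ v) := by
  have key : ∀ s ∈ S, ∀ b, b ∉ U → b ∈ CN s → f s ≠ φ b := by
    intro s hs b hb hbs e
    have := hf s hs
    simp only [avl, Finset.mem_sdiff, Finset.mem_image, not_exists, not_and] at this
    exact this.2 b ⟨hbs, hb⟩ e.symm
  constructor
  · intro a ha
    by_cases haS : a ∈ S
    · have := hf a haS
      simp only [avl, Finset.mem_sdiff] at this
      simpa [haS] using this.1
    · simp only [haS, if_false]
      exact h.1 a (by simp at ha; tauto)
  · intro a ha b hb hab
    have hne : a ≠ b := fun e => hirr a (by rw [← e] at hab; exact hab)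
    simp only [Finset.mem_sdiff, not_and, not_not] at ha hb
    by_cases haS : a ∈ S <;> by_cases hbS : b ∈ S <;> simp only [haS, hbS, if_true, if_false]
    · exact hinj a haS b hbS hne
    · exact key a haS b (by tauto) hab
    · exact (key b hbS a (by tauto) (hsymm _ _ hab)).symm
    · exact h.2 a (by tauto) b (by tauto) hab

lemma POff.hall {V : Type*} [DecidableEq V] {CN : V → Finset V} {L : V → Finset ℕ}
    {U : Finset V} {φ : V → ℕ} (h : POff CN L U φ)
    (hsymm : ∀ a b, b ∈ CN a → a ∈ CN b) (hirr : ∀ a, a ∉ CN a)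
    (hno : ∀ ψ, ¬ POff CN L ∅ ψ) (hU : U.card ≤ 4) (hL : ∀ v, (L v).card = 6)
    (hE : ∀ s ∈ U, (CN s \ U).card ≤ 3) :
    ∃ T : Finset ℕ, ∀ s ∈ U, (CN s \ U).card = 3 ∧ Set.InjOn φ (CN s \ U : Finset V) ∧
      Disjoint T ((CN s \ U).image φ) ∧ T ∪ (CN s \ U).image φ = L s := by
  have h3 : ∀ s ∈ U, 3 ≤ (avl CN L U φ s).card := by
    intro s hs
    have h1 := Finset.le_card_sdiff ((CN s \ U).image φ) (L s)
    have h2 := Finset.card_image_le (s := CN s \ U) (f := φ)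
    have := hE s hs
    rw [hL] at h1
    unfold avl; omega
  have hn : ¬ ∃ f : U → ℕ, Function.Injective f ∧ ∀ s : U, f s ∈ avl CN L U φ s := by
    rintro ⟨f, hf, hf'⟩
    refine hno _ (Finset.sdiff_self U ▸ h.glue (S := U)
      (f := fun v => if h : v ∈ U then f ⟨v, h⟩ else 0) hsymm hirr ?_ ?_)
    · intro s hs; simpa [hs] using hf' ⟨s, hs⟩
    · intro s hs t ht hst
      simp only [hs, ht, dif_pos]
      intro e; exact hst (by simpa using hf e)
  rw [← Finset.all_card_le_biUnion_card_iff_exists_injective (fun s : U => avl CN L U φ s)] at hn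
  push Not at hn
  obtain ⟨S, hS⟩ := hn
  have hsub : ∀ s ∈ S, avl CN L U φ s ⊆ S.biUnion (fun s : U => avl CN L U φ s) :=
    fun s hs => Finset.subset_biUnion_of_mem (fun s : U => avl CN L U φ s) hs
  have hSne : S.Nonempty := by
    rw [← Finset.card_pos]; omega
  obtain ⟨s0, hs0⟩ := hSne
  have hb3 := (h3 s0 s0.2).trans (Finset.card_le_card (hsub s0 hs0))
  have hSU : S = Finset.univ := by
    apply Finset.eq_univ_of_card
    have : S.card ≤ Fintype.card U := Finset.card_le_univ S
    rw [Fintype.card_coe] at *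
    omega
  have hSc : S.card ≤ 4 := (Finset.card_le_univ S).trans (by simpa using hU)
  refine ⟨S.biUnion (fun s : U => avl CN L U φ s), fun s hs => ?_⟩
  have hsS : (⟨s, hs⟩ : U) ∈ S := by rw [hSU]; exact Finset.mem_univ _
  have heq : avl CN L U φ s = S.biUnion (fun s : U => avl CN L U φ s) := by
    apply Finset.eq_of_subset_of_card_le (hsub ⟨s, hs⟩ hsS)
    have : 3 ≤ (avl CN L U φ (⟨s, hs⟩ : U)).card := h3 s hs
    omega
  have hc3 : (avl CN L U φ s).card = 3 := by
    have := h3 s hs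
    have : (avl CN L U φ s).card = _ := congrArg Finset.card heq
    omega
  rw [← heq]
  have h2 := Finset.card_image_le (s := CN s \ U) (f := φ)
  have h4 := hE s hs
  have h5 : (L s).card ≤ (avl CN L U φ s ∪ (CN s \ U).image φ).card := by
    apply Finset.card_le_card
    unfold avl
    simp
  have h6 := Finset.card_union_le (avl CN L U φ s) ((CN s \ U).image φ)
  rw [hL] at h5
  have h7 : ((CN s \ U).image φ).card = 3 := by omega
  refine ⟨by omega, ?_, ?_, ?_⟩
  · exact Finset.card_image_iff.mp (by omega)
  · unfold avl; exact Finset.sdiff_disjoint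
  · have hd : Disjoint (avl CN L U φ s) ((CN s \ U).image φ) := by
      unfold avl; exact Finset.sdiff_disjoint
    have : (CN s \ U).image φ ⊆ L s := by
      have h8 := Finset.card_inter_add_card_sdiff (L s) ((CN s \ U).image φ)
      unfold avl at hc3
      rw [hL] at h8
      have : L s ∩ ((CN s \ U).image φ) = (CN s \ U).image φ :=
        Finset.eq_of_subset_of_card_le Finset.inter_subset_right (by omega)
      rw [← this]; exact Finset.inter_subset_left
    unfold avl
    exact Finset.sdiff_union_of_subset this

open Classical in
lemma start_col {V : Type*} [Fintype V] (G : SimpleGraph V) (hmin : ProperSubgraphsCh3dLE G 6)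
    (U : Finset V) (hne : U.Nonempty)
    (hU : ∀ v ∈ U, ((Finset.univ.filter (G.Adj v)) \ U).card ≤ 1)
    (L : V → Finset ℕ) (hL : ∀ v, 6 ≤ (L v).card) :
    ∃ (φ : V → ℕ) (R : V → Finset V), (∀ v, R v ⊆ Finset.univ.filter (G.Adj v)) ∧
      (∀ v, (R v).card = min 3 (Finset.univ.filter (G.Adj v)).card) ∧
      (∀ v, v ∉ U → φ v ∈ L v) ∧ (∀ a, a ∉ U → ∀ b, b ∉ U → G.Adj a b → φ a ≠ φ b) ∧
      ∀ v, Set.InjOn φ (R v \ U : Finset V) := by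
  set H : G.Subgraph := (⊤ : G.Subgraph).deleteVerts (U : Set V) with hH
  have hHv : ∀ v, v ∈ H.verts ↔ v ∉ U := by intro v; simp [hH]
  have hHne : H ≠ ⊤ := by
    intro e
    obtain ⟨v, hv⟩ := hne
    have := hHv v
    rw [e] at this
    simp at this
    exact this hv
  have hHA : ∀ a b : H.verts, H.coe.Adj a b ↔ G.Adj a b := by
    intro a b
    have ha := (hHv a).1 a.2
    have hb := (hHv b).1 b.2
    simp [hH, ha, hb]
  obtain ⟨φ', ⟨hp, hd⟩, hl⟩ := hmin H hHne (fun v => L v) (fun v => hL v)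
  let φ : V → ℕ := fun v => if h : v ∈ H.verts then φ' ⟨v, h⟩ else 0
  have hφ : ∀ (v : V) (h : v ∈ H.verts), φ v = φ' ⟨v, h⟩ := fun v h => dif_pos h
  have hcard : ∀ v, min 3 (Finset.univ.filter (G.Adj v) \ U).card ≤
      ((Finset.univ.filter (G.Adj v) \ U).image φ).card := by
    intro v
    by_cases hv : v ∈ U
    · have h1 := hU v hv
      have : ((Finset.univ.filter (G.Adj v) \ U).image φ).card
          = (Finset.univ.filter (G.Adj v) \ U).card := by
        rw [Finset.card_image_iff]
        intro a ha b hb _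
        exact Finset.card_le_one.mp h1 a ha b hb
      omega
    · have h1 := hd ⟨v, (hHv v).2 hv⟩
      have e1 : ((fun a : H.verts => (a : V)) '' (H.coe.neighborSet ⟨v, (hHv v).2 hv⟩))
          = ((Finset.univ.filter (G.Adj v) \ U : Finset V) : Set V) := by
        ext t
        simp only [Set.mem_image, SimpleGraph.mem_neighborSet, hHA, Finset.coe_sdiff,
          Finset.coe_filter, Finset.mem_univ, true_and, Set.mem_sdiff, Set.mem_ofPred_eq,
          Finset.mem_coe]
        constructor
        · rintro ⟨a, ha, rfl⟩; exact ⟨ha, (hHv a).1 a.2⟩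
        · rintro ⟨ha, hb⟩; exact ⟨⟨t, (hHv t).2 hb⟩, ha, rfl⟩
      have e2 : φ' '' (H.coe.neighborSet ⟨v, (hHv v).2 hv⟩)
          = (((Finset.univ.filter (G.Adj v) \ U).image φ : Finset ℕ) : Set ℕ) := by
        rw [Finset.coe_image, ← e1, Set.image_image]
        apply Set.image_congr
        intro a _
        exact (hφ a a.2).symm
      rw [e2, Set.ncard_coe_finset, ← Set.ncard_image_of_injective _ Subtype.val_injective, e1,
        Set.ncard_coe_finset] at h1
      exact h1
  have hR : ∀ v, ∃ R : Finset V, R ⊆ Finset.univ.filter (G.Adj v) ∧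
      R.card = min 3 (Finset.univ.filter (G.Adj v)).card ∧ Set.InjOn φ (R \ U : Finset V) := by
    intro v
    obtain ⟨I, hI, hIc⟩ := Finset.exists_subset_card_eq (hcard v)
    obtain ⟨R', hR', hinj, him⟩ : ∃ R' ⊆ Finset.univ.filter (G.Adj v) \ U, Set.InjOn φ R' ∧
        R'.image φ = I := by
      obtain ⟨R', h1, h2, h3⟩ := Finset.exists_subset_injOn_image_eq_of_surjOn
        (f := φ) (Finset.univ.filter (G.Adj v) \ U : Finset V) I (by
          intro c hc
          have := hI hc
          rw [Finset.mem_image] at this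
          exact this)
      exact ⟨R', by exact_mod_cast h1, h2, h3⟩
    have hRc : R'.card = min 3 (Finset.univ.filter (G.Adj v) \ U).card := by
      rw [← hIc, ← him, Finset.card_image_of_injOn hinj]
    have hle : (Finset.univ.filter (G.Adj v) \ U).card ≤ (Finset.univ.filter (G.Adj v)).card :=
      Finset.card_le_card Finset.sdiff_subset
    obtain ⟨R, h1, h2, h3⟩ := Finset.exists_subsuperset_card_eq
      (hR'.trans Finset.sdiff_subset) (n := min 3 (Finset.univ.filter (G.Adj v)).card)
      (by omega) (by omega)
    refine ⟨R, h2, h3, ?_⟩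
    apply hinj.mono
    by_cases h4 : 3 ≤ (Finset.univ.filter (G.Adj v) \ U).card
    · have : R' = R := Finset.eq_of_subset_of_card_le h1 (by omega)
      rw [this]; exact_mod_cast Finset.sdiff_subset
    · have : R' = Finset.univ.filter (G.Adj v) \ U :=
        Finset.eq_of_subset_of_card_le hR' (by omega)
      rw [this]; exact_mod_cast Finset.sdiff_subset_sdiff h2 le_rfl
  choose R hR1 hR2 hR3 using hR
  refine ⟨φ, R, hR1, hR2, ?_, ?_, hR3⟩
  · intro v hv
    rw [hφ v ((hHv v).2 hv)]
    exact hl _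
  · intro a ha b hb hab
    rw [hφ a ((hHv a).2 ha), hφ b ((hHv b).2 hb)]
    exact hp _ _ ((hHA _ _).2 hab)

open Classical in
lemma finish_col {V : Type*} [Fintype V] (G : SimpleGraph V) (L : V → Finset ℕ)
    (R : V → Finset V) (hR1 : ∀ v, R v ⊆ Finset.univ.filter (G.Adj v))
    (hR2 : ∀ v, (R v).card = min 3 (Finset.univ.filter (G.Adj v)).card)
    (ψ : V → ℕ) (hl : ∀ v, ψ v ∈ L v)
    (hc : ∀ a b, b ≠ a → (G.Adj a b ∨ ∃ v, a ∈ R v ∧ b ∈ R v) → ψ a ≠ ψ b) :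
    Dyn3ListColorable G L := by
  refine ⟨ψ, ⟨fun a b hab => hc a b hab.ne' (Or.inl hab), fun v => ?_⟩, hl⟩
  have e : G.neighborSet v = ((Finset.univ.filter (G.Adj v) : Finset V) : Set V) := by
    ext; simp
  rw [e, Set.ncard_coe_finset, ← hR2, ← Finset.coe_image, Set.ncard_coe_finset]
  have : ((R v).image ψ).card = (R v).card := by
    apply Finset.card_image_of_injOn
    intro a ha b hb hab
    by_contra hne
    exact hc a b (Ne.symm hne) (Or.inr ⟨v, ha, hb⟩) hab
  rw [← this]
  exact Finset.card_le_card (Finset.image_subset_image (hR1 v))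

lemma avl_card {V : Type*} [DecidableEq V] {CN : V → Finset V} {L : V → Finset ℕ}
    {U : Finset V} {φ : V → ℕ} {s : V} (hL : (L s).card = 6) (A : Finset V)
    (h : CN s \ U ⊆ A) : 6 - A.card ≤ (avl CN L U φ s).card := by
  have h0 := Finset.card_le_card h
  have h1 := Finset.le_card_sdiff ((CN s \ U).image φ) (L s)
  have h2 := Finset.card_image_le (s := CN s \ U) (f := φ)
  unfold avl; omega

lemma det_pt {V : Type*} [DecidableEq V] {T : Finset ℕ} {E : Finset V} {φ ψ : V → ℕ} {e : V}
    (he : e ∈ E) (h : T ∪ E.image φ = T ∪ E.image ψ) (hd : Disjoint T (E.image φ))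
    (hi : Set.InjOn φ E) (hag : ∀ t ∈ E, t ≠ e → φ t = ψ t) : φ e = ψ e := by
  have h1 : φ e ∈ T ∪ E.image ψ := by
    rw [← h]; exact Finset.mem_union_right _ (Finset.mem_image_of_mem _ he)
  have h2 : φ e ∉ T := Finset.disjoint_right.mp hd (Finset.mem_image_of_mem _ he)
  rw [Finset.mem_union, Finset.mem_image] at h1
  obtain h1 | ⟨t, ht, h1⟩ := h1
  · exact absurd h1 h2
  · by_cases hte : t = e
    · rw [← h1, hte]
    · rw [← hag t ht hte] at h1
      exact absurd (hi ht he h1) hte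

lemma det_T {V : Type*} [DecidableEq V] {T T' : Finset ℕ} {E : Finset V} {φ ψ : V → ℕ}
    (h : T ∪ E.image φ = T' ∪ E.image ψ) (hd : Disjoint T (E.image φ))
    (hd' : Disjoint T' (E.image ψ)) (hag : ∀ t ∈ E, φ t = ψ t) : T = T' := by
  have e : E.image φ = E.image ψ := Finset.image_congr hag
  rw [e] at h hd
  have := congrArg (· \ E.image ψ) h
  simpa [Finset.union_sdiff_right, Finset.sdiff_eq_self_of_disjoint hd,
    Finset.sdiff_eq_self_of_disjoint hd'] using this

structure Cfg {V : Type*} [DecidableEq V] (CN : V → Finset V)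
    (x y z u w w1 w2 z1 z2 y1 y2 v1 v2 t1 t2 : V) (b1 b2 c1 c2 : Finset V) : Prop where
  symm : ∀ a b, b ∈ CN a → a ∈ CN b
  irr : ∀ a, a ∉ CN a
  nodup : [x, y, z, u, w].Nodup
  w12 : w1 ≠ w2
  z12 : z1 ≠ z2
  w1n : w1 ∉ [x, y, z, u, w]
  w2n : w2 ∉ [x, y, z, u, w]
  z1n : z1 ∉ [x, y, z, u, w]
  z2n : z2 ∉ [x, y, z, u, w]
  Nu : CN u ⊆ {x, w, y, z, w1, w2}
  Nx : CN x ⊆ {y, z, u, y1, y2, z1, z2, w}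
  Nw : CN w ⊆ {u, w1, w2, x, v1, v2}
  Nw1 : CN w1 ⊆ {w, u, w2} ∪ b1
  Nw2 : CN w2 ⊆ {w, u, w1} ∪ b2
  Nz : CN z ⊆ {x, z1, z2, y, u, t1, t2}
  Nz1 : CN z1 ⊆ {z, x, z2} ∪ c1
  Nz2 : CN z2 ⊆ {z, x, z1} ∪ c2
  cl1 : z ∈ CN x
  cl2 : z1 ∈ CN x
  cl3 : z2 ∈ CN x
  cl4 : z1 ∈ CN z
  cl5 : z2 ∈ CN z
  cl6 : z2 ∈ CN z1
  b1c : b1.card ≤ 3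
  b2c : b2.card ≤ 3
  c1c : c1.card ≤ 3
  c2c : c2.card ≤ 3
  v1z1 : v1 = z1 → b1.card ≤ 2
  v1z2 : v1 = z2 → b1.card ≤ 2
  v2z1 : v2 = z1 → b2.card ≤ 2
  v2z2 : v2 = z2 → b2.card ≤ 2
  v1z : v1 = z → w1 = z1 ∨ w1 = z2
  v2z : v2 = z → w2 = z1 ∨ w2 = z2
  zb1 : z ∈ b1 → v1 ∈ [z, x, z1, z2]
  zb2 : z ∈ b2 → v2 ∈ [z, x, z1, z2]
  xb1 : x ∈ b1 → v1 ∈ [x, y, z]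
  xb2 : x ∈ b2 → v2 ∈ [x, y, z]
  wz11 : w1 = z1 → b1 ⊆ {z, x, z2} ∧ t1 = w
  wz12 : w1 = z2 → b1 ⊆ {z, x, z1} ∧ t2 = w
  wz21 : w2 = z1 → b2 ⊆ {z, x, z2} ∧ t1 = w
  wz22 : w2 = z2 → b2 ⊆ {z, x, z1} ∧ t2 = w

section
variable {V : Type*} [DecidableEq V] {CN : V → Finset V}
    {x y z u w w1 w2 z1 z2 y1 y2 v1 v2 t1 t2 : V} {b1 b2 c1 c2 : Finset V}

lemma Cfg.swapW (h : Cfg CN x y z u w w1 w2 z1 z2 y1 y2 v1 v2 t1 t2 b1 b2 c1 c2) :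
    Cfg CN x y z u w w2 w1 z1 z2 y1 y2 v2 v1 t1 t2 b2 b1 c1 c2 where
  symm := h.symm
  irr := h.irr
  nodup := h.nodup
  w12 := h.w12.symm
  z12 := h.z12
  w1n := h.w2n
  w2n := h.w1n
  z1n := h.z1n
  z2n := h.z2n
  Nu := h.Nu.trans (by intro a; simp; tauto)
  Nx := h.Nx
  Nw := h.Nw.trans (by intro a; simp; tauto)
  Nw1 := h.Nw2
  Nw2 := h.Nw1
  Nz := h.Nz
  Nz1 := h.Nz1
  Nz2 := h.Nz2
  cl1 := h.cl1
  cl2 := h.cl2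
  cl3 := h.cl3
  cl4 := h.cl4
  cl5 := h.cl5
  cl6 := h.cl6
  b1c := h.b2c
  b2c := h.b1c
  c1c := h.c1c
  c2c := h.c2c
  v1z1 := h.v2z1
  v1z2 := h.v2z2
  v2z1 := h.v1z1
  v2z2 := h.v1z2
  v1z := h.v2z
  v2z := h.v1z
  zb1 := h.zb2
  zb2 := h.zb1
  xb1 := h.xb2
  xb2 := h.xb1
  wz11 := h.wz21
  wz12 := h.wz22
  wz21 := h.wz11
  wz22 := h.wz12

lemma Cfg.swapZ (h : Cfg CN x y z u w w1 w2 z1 z2 y1 y2 v1 v2 t1 t2 b1 b2 c1 c2) :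
    Cfg CN x y z u w w1 w2 z2 z1 y1 y2 v1 v2 t2 t1 b1 b2 c2 c1 where
  symm := h.symm
  irr := h.irr
  nodup := h.nodup
  w12 := h.w12
  z12 := h.z12.symm
  w1n := h.w1n
  w2n := h.w2n
  z1n := h.z2n
  z2n := h.z1n
  Nu := h.Nu
  Nx := h.Nx.trans (by intro a; simp; tauto)
  Nw := h.Nw
  Nw1 := h.Nw1
  Nw2 := h.Nw2
  Nz := h.Nz.trans (by intro a; simp; tauto)
  Nz1 := h.Nz2
  Nz2 := h.Nz1
  cl1 := h.cl1
  cl2 := h.cl3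
  cl3 := h.cl2
  cl4 := h.cl5
  cl5 := h.cl4
  cl6 := h.symm _ _ h.cl6
  b1c := h.b1c
  b2c := h.b2c
  c1c := h.c2c
  c2c := h.c1c
  v1z1 := h.v1z2
  v1z2 := h.v1z1
  v2z1 := h.v2z2
  v2z2 := h.v2z1
  v1z := fun e => (h.v1z e).symm
  v2z := fun e => (h.v2z e).symm
  zb1 := fun e => by have := h.zb1 e; simp at this ⊢; tauto
  zb2 := fun e => by have := h.zb2 e; simp at this ⊢; tauto
  xb1 := h.xb1
  xb2 := h.xb2
  wz11 := h.wz12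
  wz12 := h.wz11
  wz21 := h.wz22
  wz22 := h.wz21

lemma Cfg.hall (h : Cfg CN x y z u w w1 w2 z1 z2 y1 y2 v1 v2 t1 t2 b1 b2 c1 c2)
    {L : V → Finset ℕ} (hno : ∀ ψ, ¬ POff CN L ∅ ψ) (hL : ∀ v, (L v).card = 6) {φ : V → ℕ}
    (hφ : POff CN L {u, w, w1, w2} φ) :
    ∃ T : Finset ℕ, ∀ s ∈ ({u, w, w1, w2} : Finset V),
      (CN s \ {u, w, w1, w2}).card = 3 ∧
      Set.InjOn φ (CN s \ {u, w, w1, w2} : Finset V) ∧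
      Disjoint T ((CN s \ {u, w, w1, w2}).image φ) ∧
      T ∪ (CN s \ {u, w, w1, w2}).image φ = L s := by
  apply hφ.hall h.symm h.irr hno Finset.card_le_four hL
  intro s hs
  simp only [Finset.mem_insert, Finset.mem_singleton] at hs
  rcases hs with rfl | rfl | rfl | rfl
  · refine (Finset.card_le_card (t := {x, y, z}) ?_).trans Finset.card_le_three
    intro a ha
    have h2 := h.Nu (Finset.mem_sdiff.mp ha).1
    clear * - ha h2; simp at ha h2 ⊢; grind
  · refine (Finset.card_le_card (t := {x, v1, v2}) ?_).trans Finset.card_le_three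
    intro a ha
    have h2 := h.Nw (Finset.mem_sdiff.mp ha).1
    clear * - ha h2; simp at ha h2 ⊢; grind
  · refine (Finset.card_le_card (t := b1) ?_).trans h.b1c
    intro a ha
    have h2 := h.Nw1 (Finset.mem_sdiff.mp ha).1
    clear * - ha h2; simp at ha h2 ⊢; grind
  · refine (Finset.card_le_card (t := b2) ?_).trans h.b2c
    intro a ha
    have h2 := h.Nw2 (Finset.mem_sdiff.mp ha).1
    clear * - ha h2; simp at ha h2 ⊢; grind

lemma eq3 {E : Finset V} {a b c : V} (h : E ⊆ {a, b, c}) (hc : E.card = 3) :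
    E = {a, b, c} ∧ a ≠ b ∧ a ≠ c ∧ b ≠ c := by
  have h1 := Finset.card_le_three (a := a) (b := b) (c := c)
  have h2 : E = {a, b, c} := Finset.eq_of_subset_of_card_le h (by omega)
  refine ⟨h2, ?_⟩
  rw [h2] at hc
  have := Finset.card_le_two (a := a) (b := b)
  have := Finset.card_le_two (a := a) (b := c)
  have := Finset.card_le_two (a := b) (b := c)
  refine ⟨?_, ?_, ?_⟩ <;> rintro rfl
  · simp at hc; omega
  · rw [show ({a, b, a} : Finset V) = {a, b} by ext; simp; tauto] at hc; omega
  · simp at hc; omega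

/-- consequences of Hall at a coloring -/
lemma Cfg.E (h : Cfg CN x y z u w w1 w2 z1 z2 y1 y2 v1 v2 t1 t2 b1 b2 c1 c2)
    {L : V → Finset ℕ} (hno : ∀ ψ, ¬ POff CN L ∅ ψ) (hL : ∀ v, (L v).card = 6) {φ : V → ℕ}
    (hφ : POff CN L {u, w, w1, w2} φ) :
    CN u \ {u, w, w1, w2} = {x, y, z} ∧ CN w \ {u, w, w1, w2} = {x, v1, v2} ∧
    v1 ≠ x ∧ v2 ≠ x ∧ v1 ≠ v2 ∧ CN w1 \ {u, w, w1, w2} = b1 ∧ CN w2 \ {u, w, w1, w2} = b2 ∧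
    b1.card = 3 ∧ b2.card = 3 := by
  obtain ⟨T, hT⟩ := h.hall hno hL hφ
  have hu := (hT u (by simp)).1
  have hw := (hT w (by simp)).1
  have hw1 := (hT w1 (by simp)).1
  have hw2 := (hT w2 (by simp)).1
  have eu := eq3 (a := x) (b := y) (c := z) (E := CN u \ {u, w, w1, w2}) (by
    intro a ha
    have h2 := h.Nu (Finset.mem_sdiff.mp ha).1
    clear * - ha h2; simp at ha h2 ⊢; grind) hu
  have ew := eq3 (a := x) (b := v1) (c := v2) (E := CN w \ {u, w, w1, w2}) (by
    intro a ha
    have h2 := h.Nw (Finset.mem_sdiff.mp ha).1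
    clear * - ha h2; simp at ha h2 ⊢; grind) hw
  have e1 : CN w1 \ {u, w, w1, w2} = b1 := by
    apply Finset.eq_of_subset_of_card_le
    · intro a ha
      have h2 := h.Nw1 (Finset.mem_sdiff.mp ha).1
      clear * - ha h2; simp at ha h2 ⊢; grind
    · have := h.b1c; omega
  have e2 : CN w2 \ {u, w, w1, w2} = b2 := by
    apply Finset.eq_of_subset_of_card_le
    · intro a ha
      have h2 := h.Nw2 (Finset.mem_sdiff.mp ha).1
      clear * - ha h2; simp at ha h2 ⊢; grind
    · have := h.b2c; omega
  exact ⟨eu.1, ew.1, ew.2.1.symm, ew.2.2.1.symm, ew.2.2.2, e1, e2, by rw [← e1]; exact hw1,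
    by rw [← e2]; exact hw2⟩

/-- case II -/
lemma Cfg.caseII (h : Cfg CN x y z u w w1 w2 z1 z2 y1 y2 v1 v2 t1 t2 b1 b2 c1 c2)
    {L : V → Finset ℕ} (hno : ∀ ψ, ¬ POff CN L ∅ ψ) (hL : ∀ v, (L v).card = 6) {φ : V → ℕ}
    (hφ : POff CN L {u, w, w1, w2} φ) : w1 ≠ z1 := by
  intro hwz
  obtain ⟨hb, ht⟩ := h.wz11 hwz
  obtain ⟨Eu, Ew, -, -, -, E1, E2, B1, B2⟩ := h.E hno hL hφ
  have nd := h.nodup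
  have z2n := h.z2n
  have w1n := h.w1n
  have w2n := h.w2n
  have z1n := h.z1n
  have z12 := h.z12
  have w12 := h.w12
  simp at nd z2n w1n w2n z1n
  have hbe := (eq3 hb B1).1
  have hw2z : w2 ≠ z2 := by
    intro e
    have : z2 ∈ CN w1 \ {u, w, w1, w2} := by rw [E1, hbe]; simp
    simp [e] at this
  have hP := hφ.mono (U' := {u, w, w1, w2} ∪ {z, z2}) Finset.subset_union_left
  have a1 := avl_card (CN := CN) (φ := φ) (s := z2) (U := {u, w, w1, w2} ∪ {z, z2}) (hL z2)
    ({x} ∪ c2) (by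
      intro a ha
      have h2 := h.Nz2 (Finset.mem_sdiff.mp ha).1
      clear * - ha h2 hwz; simp [hwz] at ha h2 ⊢; grind)
  have a2 := avl_card (CN := CN) (φ := φ) (s := z) (U := {u, w, w1, w2} ∪ {z, z2}) (hL z)
    {x, y, t2} (by
      intro a ha
      have h2 := h.Nz (Finset.mem_sdiff.mp ha).1
      clear * - ha h2 hwz ht; simp [hwz, ht] at ha h2 ⊢; grind)
  have a3 := Finset.card_union_le {x} c2
  have a4 := h.c2c
  have a5 := Finset.card_le_three (a := x) (b := y) (c := t2)
  simp only [Finset.card_singleton] at a3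
  obtain ⟨r, hr, hr'⟩ := ex_ne1 (show 2 ≤ _ by omega) (φ z2)
    (X := avl CN L ({u, w, w1, w2} ∪ {z, z2}) φ z2)
  obtain ⟨q, hq, hq'⟩ := ex_ne1 (show 2 ≤ _ by omega) r
    (X := avl CN L ({u, w, w1, w2} ∪ {z, z2}) φ z)
  have hG := hP.glue h.symm h.irr (S := {z, z2}) (f := fun v => if v = z then q else r) (by
      intro s hs
      simp only [Finset.mem_insert, Finset.mem_singleton] at hs
      rcases hs with rfl | rfl
      · simpa using hq
      · simpa [z2n] using hr) (by
      intro s hs t ht hst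
      simp only [Finset.mem_insert, Finset.mem_singleton] at hs ht
      rcases hs with rfl | rfl <;> rcases ht with rfl | rfl <;> grind)
  have hUU : (({u, w, w1, w2} ∪ {z, z2}) \ {z, z2} : Finset V) = {u, w, w1, w2} := by
    ext a; simp; grind
  rw [hUU] at hG
  set ψ : V → ℕ := fun v => if v ∈ ({z, z2} : Finset V) then
    (fun v => if v = z then q else r) v else φ v with hψ
  have p1 : ψ x = φ x := by simp [hψ]; grind
  have p2 : ψ y = φ y := by simp [hψ]; grind
  have p4 : ψ z2 = r := by simp [hψ]; grind
  obtain ⟨T, hT⟩ := h.hall hno hL hφ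
  obtain ⟨T', hT'⟩ := h.hall hno hL hG
  obtain ⟨-, i1, d1, l1⟩ := hT u (by simp)
  obtain ⟨-, i2, d2, l2⟩ := hT w1 (by simp)
  obtain ⟨-, i3, d3, l3⟩ := hT' u (by simp)
  obtain ⟨-, i4, d4, l4⟩ := hT' w1 (by simp)
  rw [E1, hbe] at i2 d2 l2 i4 d4 l4
  rw [Eu] at i1 d1 l1 i3 d3 l3
  clear_value ψ
  rw [← p4] at hr'
  have k1 : φ z2 ∈ T' ∪ Finset.image ψ {z, x, z2} := by rw [l4, ← l2]; simp
  have k2 : φ z2 ∉ T := by simp at d2; tauto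
  have k3 : φ z2 ≠ φ x := fun e => z2n.1 (i2 (by simp) (by simp) e)
  have k4 : φ z2 ≠ φ z := fun e => z2n.2.2.1 (i2 (by simp) (by simp) e)
  have k5 : ψ z ≠ ψ y := fun e => nd.2.1.1 (i3 (by simp) (by simp) e).symm
  have k6 : ψ y ∉ T' := by simp at d3; tauto
  have k7 : φ z2 ∈ T' ∨ φ z2 = ψ z := by simp at k1; grind
  have k8 : φ z2 ∈ T ∪ Finset.image φ {x, y, z} := by
    rw [l1, ← l3]; simp; tauto
  simp at k8
  grind

/-- some `w_i` conflicts with some `z_j` -/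
lemma Cfg.caseG (h : Cfg CN x y z u w w1 w2 z1 z2 y1 y2 v1 v2 t1 t2 b1 b2 c1 c2)
    {L : V → Finset ℕ} (hno : ∀ ψ, ¬ POff CN L ∅ ψ) (hL : ∀ v, (L v).card = 6) {φ : V → ℕ}
    (hφ : POff CN L {u, w, w1, w2} φ) (n1 : w1 ≠ z1) (n2 : w1 ≠ z2) (n3 : w2 ≠ z1)
    (n4 : w2 ≠ z2) : z1 ∉ b1 := by
  intro hwz
  obtain ⟨Eu, Ew, v1x, v2x, -, E1, E2, B1, B2⟩ := h.E hno hL hφ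
  have nd := h.nodup
  have z2n := h.z2n
  have w1n := h.w1n
  have w2n := h.w2n
  have z1n := h.z1n
  have z12 := h.z12
  have w12 := h.w12
  have m1 := h.v1z1
  have m2 := h.v1z2
  have m3 := h.v2z1
  have m4 := h.v2z2
  have m5 := h.v1z
  have m6 := h.v2z
  simp at nd z2n w1n w2n z1n
  have hwc : w1 ∈ c1 := by
    rw [← E1, Finset.mem_sdiff] at hwz
    have h2 := h.Nz1 (h.symm _ _ hwz.1)
    clear * - h2 w1n n2
    simp [w1n, n2] at h2; exact h2
  have hP := hφ.mono (U' := {u, w, w1, w2} ∪ {z, z1, z2}) Finset.subset_union_left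
  have a1 := avl_card (CN := CN) (φ := φ) (s := z1) (U := {u, w, w1, w2} ∪ {z, z1, z2}) (hL z1)
    ({x} ∪ c1.erase w1) (by
      intro a ha
      have h2 := h.Nz1 (Finset.mem_sdiff.mp ha).1
      clear * - ha h2; simp at ha h2 ⊢; grind)
  have a2 := avl_card (CN := CN) (φ := φ) (s := z2) (U := {u, w, w1, w2} ∪ {z, z1, z2}) (hL z2)
    ({x} ∪ c2) (by
      intro a ha
      have h2 := h.Nz2 (Finset.mem_sdiff.mp ha).1
      clear * - ha h2; simp at ha h2 ⊢; grind)
  have a3 := avl_card (CN := CN) (φ := φ) (s := z) (U := {u, w, w1, w2} ∪ {z, z1, z2}) (hL z)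
    {x, y, t1, t2} (by
      intro a ha
      have h2 := h.Nz (Finset.mem_sdiff.mp ha).1
      clear * - ha h2; simp at ha h2 ⊢; grind)
  have a4 := Finset.card_union_le {x} c2
  have a5 := Finset.card_union_le {x} (c1.erase w1)
  have a6 := h.c2c
  have a7 := h.c1c
  have a8 := Finset.card_erase_add_one hwc
  have a9 := Finset.card_le_four (a := x) (b := y) (c := t1) (d := t2)
  simp only [Finset.card_singleton] at a4 a5
  obtain ⟨q, hq, s, hs, r, hr, o1, o2, o3, o4⟩ := sdr3
    (Z := avl CN L ({u, w, w1, w2} ∪ {z, z1, z2}) φ z)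
    (A := avl CN L ({u, w, w1, w2} ∪ {z, z1, z2}) φ z2)
    (B := avl CN L ({u, w, w1, w2} ∪ {z, z1, z2}) φ z1)
    (by omega) (by omega) (by omega) (φ z)
  have hG := hP.glue h.symm h.irr (S := {z, z1, z2})
    (f := fun v => if v = z then q else if v = z1 then r else s) (by
      intro s hs
      simp only [Finset.mem_insert, Finset.mem_singleton] at hs
      rcases hs with rfl | rfl | rfl
      · simpa using hq
      · simpa [z1n] using hr
      · simpa [z2n, z12.symm] using hs) (by
      intro s hs t ht hst
      simp only [Finset.mem_insert, Finset.mem_singleton] at hs ht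
      rcases hs with rfl | rfl | rfl <;> rcases ht with rfl | rfl | rfl <;> grind)
  have hUU : (({u, w, w1, w2} ∪ {z, z1, z2}) \ {z, z1, z2} : Finset V) = {u, w, w1, w2} := by
    ext a; simp; grind
  rw [hUU] at hG
  set ψ : V → ℕ := fun v => if v ∈ ({z, z1, z2} : Finset V) then
    (fun v => if v = z then q else if v = z1 then r else s) v else φ v with hψ
  have p1 : ∀ t, t ≠ z → t ≠ z1 → t ≠ z2 → φ t = ψ t := by
    intro t _ _ _; simp [hψ]; grind
  have p2 : ψ z = q := by simp [hψ]
  obtain ⟨T, hT⟩ := h.hall hno hL hφ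
  obtain ⟨T', hT'⟩ := h.hall hno hL hG
  obtain ⟨-, i1, d1, l1⟩ := hT u (by simp)
  obtain ⟨-, i2, d2, l2⟩ := hT w (by simp)
  obtain ⟨-, i3, d3, l3⟩ := hT' u (by simp)
  obtain ⟨-, i4, d4, l4⟩ := hT' w (by simp)
  rw [Ew] at i2 d2 l2 i4 d4 l4
  rw [Eu] at i1 d1 l1 i3 d3 l3
  clear_value ψ
  have hTT : T = T' := det_T (l2.trans l4.symm) d2 d4 (by
    intro t ht
    apply p1 <;> (simp at ht; grind))
  subst hTT
  have := det_pt (e := z) (by simp) (l1.trans l3.symm) d1 i1 (by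
    intro t ht hne
    apply p1 <;> (simp at ht; grind))
  exact o4 (by rw [← p2, this])

/-- `w_2` untouched -/
lemma Cfg.caseA (h : Cfg CN x y z u w w1 w2 z1 z2 y1 y2 v1 v2 t1 t2 b1 b2 c1 c2)
    {L : V → Finset ℕ} (hno : ∀ ψ, ¬ POff CN L ∅ ψ) (hL : ∀ v, (L v).card = 6) {φ : V → ℕ}
    (hφ : POff CN L {u, w, w1, w2} φ) (n1 : w1 ≠ z1) (n2 : w1 ≠ z2) (n3 : w2 ≠ z1)
    (n4 : w2 ≠ z2) (n5 : z1 ∉ b2) (n6 : z2 ∉ b2) : x ∈ b2 ∨ z ∈ b2 := by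
  by_contra hcon
  push Not at hcon
  obtain ⟨n7, n8⟩ := hcon
  obtain ⟨Eu, Ew, v1x, v2x, -, E1, E2, B1, B2⟩ := h.E hno hL hφ
  have nd := h.nodup
  have z2n := h.z2n
  have w1n := h.w1n
  have w2n := h.w2n
  have z1n := h.z1n
  have z12 := h.z12
  have w12 := h.w12
  have m1 := h.v1z1
  have m2 := h.v1z2
  have m3 := h.v2z1
  have m4 := h.v2z2
  have m5 := h.v1z
  have m6 := h.v2z
  simp at nd z2n w1n w2n z1n
  have hP := hφ.mono (U' := {u, w, w1, w2} ∪ {x, z, z1, z2}) Finset.subset_union_left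
  have a1 := avl_card (CN := CN) (φ := φ) (s := z1) (U := {u, w, w1, w2} ∪ {x, z, z1, z2})
    (hL z1) c1 (by
      intro a ha
      have h2 := h.Nz1 (Finset.mem_sdiff.mp ha).1
      clear * - ha h2; simp at ha h2 ⊢; grind)
  have a2 := avl_card (CN := CN) (φ := φ) (s := z2) (U := {u, w, w1, w2} ∪ {x, z, z1, z2})
    (hL z2) c2 (by
      intro a ha
      have h2 := h.Nz2 (Finset.mem_sdiff.mp ha).1
      clear * - ha h2; simp at ha h2 ⊢; grind)
  have a3 := avl_card (CN := CN) (φ := φ) (s := z) (U := {u, w, w1, w2} ∪ {x, z, z1, z2}) (hL z)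
    {y, t1, t2} (by
      intro a ha
      have h2 := h.Nz (Finset.mem_sdiff.mp ha).1
      clear * - ha h2; simp at ha h2 ⊢; grind)
  have a4 := avl_card (CN := CN) (φ := φ) (s := x) (U := {u, w, w1, w2} ∪ {x, z, z1, z2}) (hL x)
    {y, y1, y2} (by
      intro a ha
      have h2 := h.Nx (Finset.mem_sdiff.mp ha).1
      clear * - ha h2; simp at ha h2 ⊢; grind)
  have a6 := h.c2c
  have a7 := h.c1c
  have a8 := Finset.card_le_three (a := y) (b := t1) (c := t2)
  have a9 := Finset.card_le_three (a := y) (b := y1) (c := y2)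
  have xU : x ∉ ({u, w, w1, w2} : Finset V) := by simp; grind
  have zU : z ∉ ({u, w, w1, w2} : Finset V) := by simp; grind
  have z1U : z1 ∉ ({u, w, w1, w2} : Finset V) := by simp; grind
  have z2U : z2 ∉ ({u, w, w1, w2} : Finset V) := by simp; grind
  obtain ⟨p, hp, q, hq, r, hr, s, hs, o1, o2, o3, o4, o5, o6, o7⟩ := sdr4
    (X := avl CN L ({u, w, w1, w2} ∪ {x, z, z1, z2}) φ x)
    (Z := avl CN L ({u, w, w1, w2} ∪ {x, z, z1, z2}) φ z)
    (A := avl CN L ({u, w, w1, w2} ∪ {x, z, z1, z2}) φ z1)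
    (B := avl CN L ({u, w, w1, w2} ∪ {x, z, z1, z2}) φ z2)
    (by omega) (by omega) (by omega) (by omega)
    (hφ.mem_avl Finset.subset_union_left xU) (hφ.mem_avl Finset.subset_union_left zU)
    (hφ.mem_avl Finset.subset_union_left z1U) (hφ.mem_avl Finset.subset_union_left z2U)
    (hφ.2 x xU z zU h.cl1) (hφ.2 x xU z1 z1U h.cl2) (hφ.2 x xU z2 z2U h.cl3)
    (hφ.2 z zU z1 z1U h.cl4) (hφ.2 z zU z2 z2U h.cl5) (hφ.2 z1 z1U z2 z2U h.cl6)
  have hG := hP.glue h.symm h.irr (S := {x, z, z1, z2})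
    (f := fun v => if v = x then p else if v = z then q else if v = z1 then r else s) (by
      intro s hs
      simp only [Finset.mem_insert, Finset.mem_singleton] at hs
      rcases hs with rfl | rfl | rfl | rfl
      · simpa using hp
      · simpa [Ne.symm nd.1.2.1] using hq
      · simpa [z1n] using hr
      · simpa [z2n, z12.symm] using hs) (by
      intro s hs t ht hst
      simp only [Finset.mem_insert, Finset.mem_singleton] at hs ht
      rcases hs with rfl | rfl | rfl | rfl <;> rcases ht with rfl | rfl | rfl | rfl <;> grind)
  have hUU : (({u, w, w1, w2} ∪ {x, z, z1, z2}) \ {x, z, z1, z2} : Finset V)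
      = {u, w, w1, w2} := by
    ext a; simp; grind
  rw [hUU] at hG
  set ψ : V → ℕ := fun v => if v ∈ ({x, z, z1, z2} : Finset V) then
    (fun v => if v = x then p else if v = z then q else if v = z1 then r else s) v else φ v with hψ
  have p1 : ∀ t, t ≠ x → t ≠ z → t ≠ z1 → t ≠ z2 → φ t = ψ t := by
    intro t _ _ _ _; simp [hψ]; grind
  have p2 : ψ x = p := by simp [hψ]
  have p3 : ψ z = q := by simp [hψ]; grind
  obtain ⟨T, hT⟩ := h.hall hno hL hφ
  obtain ⟨T', hT'⟩ := h.hall hno hL hG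
  obtain ⟨-, i1, d1, l1⟩ := hT u (by simp)
  obtain ⟨-, i2, d2, l2⟩ := hT w (by simp)
  obtain ⟨-, i3, d3, l3⟩ := hT' u (by simp)
  obtain ⟨-, i4, d4, l4⟩ := hT' w (by simp)
  obtain ⟨-, i5, d5, l5⟩ := hT w2 (by simp)
  obtain ⟨-, i6, d6, l6⟩ := hT' w2 (by simp)
  rw [E2] at i5 d5 l5 i6 d6 l6
  rw [Ew] at i2 d2 l2 i4 d4 l4
  rw [Eu] at i1 d1 l1 i3 d3 l3
  clear_value ψ
  have hTT : T = T' := det_T (l5.trans l6.symm) d5 d6 (by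
    intro t ht
    apply p1 <;> (rintro rfl; contradiction))
  subst hTT
  have q1 := det_pt (e := x) (by simp) (l2.trans l4.symm) d2 i2 (by
    intro t ht hne
    apply p1 <;> (simp at ht; grind))
  have q2 := det_pt (e := z) (by simp) (l1.trans l3.symm) d1 i1 (by
    intro t ht hne
    by_cases tx : t = x
    · rw [tx]; exact q1
    · apply p1 <;> (simp at ht; grind))
  rw [p2] at q1
  rw [p3] at q2
  rcases o7 with o | o
  · exact o q1.symm
  · exact o q2.symm

lemma Cfg.false (h : Cfg CN x y z u w w1 w2 z1 z2 y1 y2 v1 v2 t1 t2 b1 b2 c1 c2)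
    {L : V → Finset ℕ} (hno : ∀ ψ, ¬ POff CN L ∅ ψ) (hL : ∀ v, (L v).card = 6) {φ : V → ℕ}
    (hφ : POff CN L {u, w, w1, w2} φ) : False := by
  have hφ' : POff CN L {u, w, w2, w1} φ := by rwa [Finset.pair_comm w2 w1]
  have n1 := h.caseII hno hL hφ
  have n2 := h.swapZ.caseII hno hL hφ
  have n3 := h.swapW.caseII hno hL hφ'
  have n4 := h.swapW.swapZ.caseII hno hL hφ'
  have g1 := h.caseG hno hL hφ n1 n2 n3 n4
  have g2 := h.swapZ.caseG hno hL hφ n2 n1 n4 n3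
  have g3 := h.swapW.caseG hno hL hφ' n3 n4 n1 n2
  have g4 := h.swapW.swapZ.caseG hno hL hφ' n4 n3 n2 n1
  have r1 := h.caseA hno hL hφ n1 n2 n3 n4 g3 g4
  have r2 := h.swapW.caseA hno hL hφ' n3 n4 n1 n2 g1 g2
  obtain ⟨Eu, Ew, v1x, v2x, v12, E1, E2, B1, B2⟩ := h.E hno hL hφ
  have m1 := h.v1z1
  have m2 := h.v1z2
  have m3 := h.v2z1
  have m4 := h.v2z2
  have m5 := h.v1z
  have m6 := h.v2z
  have k1 := h.zb1
  have k2 := h.zb2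
  have k3 := h.xb1
  have k4 := h.xb2
  simp at k1 k2 k3 k4
  have e1 : v1 = y := by grind
  have e2 : v2 = y := by grind
  exact v12 (e1.trans e2.symm)

end

set_option maxHeartbeats 1000000 in
open Classical in
lemma build_cfg {V : Type*} [Fintype V] (G : SimpleGraph V) (hG : ¬ Ch3dLE G 6)
    (hmin : ProperSubgraphsCh3dLE G 6)
    {x y z u w w1 w2 z1 z2 y1 y2 v1 v2 t1 t2 : V}
    (nodup : [x, y, z, u, w].Nodup) (w12 : w1 ≠ w2) (z12 : z1 ≠ z2)
    (w1n : w1 ∉ [x, y, z, u, w]) (w2n : w2 ∉ [x, y, z, u, w])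
    (z1n : z1 ∉ [x, y, z, u, w]) (z2n : z2 ∉ [x, y, z, u, w])
    (Nx : ∀ t, G.Adj x t ↔ t = y ∨ t = z ∨ t = u)
    (Ny : ∀ t, G.Adj y t ↔ t = x ∨ t = y1 ∨ t = y2)
    (Nz : ∀ t, G.Adj z t ↔ t = x ∨ t = z1 ∨ t = z2)
    (Nu : ∀ t, G.Adj u t ↔ t = x ∨ t = w)
    (Nw : ∀ t, G.Adj w t ↔ t = u ∨ t = w1 ∨ t = w2)
    (Nw1 : ∀ t, G.Adj w1 t ↔ t = w ∨ t = v1)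
    (Nw2 : ∀ t, G.Adj w2 t ↔ t = w ∨ t = v2)
    (Nz1 : ∀ t, G.Adj z1 t ↔ t = z ∨ t = t1)
    (Nz2 : ∀ t, G.Adj z2 t ↔ t = z ∨ t = t2) : False := by
  unfold Ch3dLE at hG
  push Not at hG
  obtain ⟨L', hL', hLn⟩ := hG
  choose L hLs hL using fun v => Finset.exists_subset_card_eq (hL' v)
  obtain ⟨φ, R, hR1, hR2, hl, hp, hi⟩ := start_col G hmin {u, w, w1, w2} (by simp) (by
    intro v hv
    have key : ∀ a, (∀ t, G.Adj v t → t ∈ ({u, w, w1, w2, a} : Finset V)) →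
        ((Finset.univ.filter (G.Adj v)) \ {u, w, w1, w2}).card ≤ 1 := by
      intro a ha
      refine (Finset.card_le_card (t := {a}) ?_).trans (by simp)
      intro t ht
      have h2 := ha t (by simpa using (Finset.mem_sdiff.mp ht).1)
      have h3 := (Finset.mem_sdiff.mp ht).2
      clear * - h2 h3
      simp at h2 h3 ⊢; grind
    simp only [Finset.mem_insert, Finset.mem_singleton] at hv
    rcases hv with rfl | rfl | rfl | rfl
    · apply key x; intro t ht; rw [Nu] at ht; simp; clear * - ht; grind
    · apply key x; intro t ht; rw [Nw] at ht; simp; clear * - ht; grind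
    · apply key v1; intro t ht; rw [Nw1] at ht; simp; clear * - ht; grind
    · apply key v2; intro t ht; rw [Nw2] at ht; simp; clear * - ht; grind) L
    (fun v => (hL v).ge)
  have hRA : ∀ v t, t ∈ R v → G.Adj v t := fun v t ht => by simpa using hR1 v ht
  have hR3 : ∀ v, (R v).card ≤ 3 := fun v => by rw [hR2]; exact min_le_left _ _
  let CN : V → Finset V := fun s => Finset.univ.filter
    (fun t => t ≠ s ∧ (G.Adj s t ∨ ∃ v, s ∈ R v ∧ t ∈ R v))
  have hCN : ∀ s t, t ∈ CN s ↔ t ≠ s ∧ (G.Adj s t ∨ ∃ v, s ∈ R v ∧ t ∈ R v) := by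
    intro s t; simp [CN]
  clear_value CN
  have hRz : ∀ t, G.Adj z t → t ∈ R z := by
    have e : Finset.univ.filter (G.Adj z) = {x, z1, z2} := by ext t; simp [Nz]
    have : R z = Finset.univ.filter (G.Adj z) := by
      apply Finset.eq_of_subset_of_card_le (hR1 z)
      rw [hR2]
      have := Finset.card_le_three (a := x) (b := z1) (c := z2)
      rw [← e] at this
      omega
    intro t ht
    rw [this]; simpa using ht
  let B : V → V → Finset V := fun s v => if s ∈ R v then insert v ((R v).erase s) else {v}
  have hBc : ∀ s v, (B s v).card ≤ 3 := by
    intro s v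
    by_cases h : s ∈ R v
    · simp only [B, h, if_true]
      have h1 := Finset.card_insert_le v ((R v).erase s)
      have h2 := Finset.card_erase_add_one h
      have h3 := hR3 v
      omega
    · simp [B, h]
  have hBm : ∀ s v t, t ∈ B s v ↔ t = v ∨ (s ∈ R v ∧ t ≠ s ∧ t ∈ R v) := by
    intro s v t
    by_cases h : s ∈ R v <;> simp [B, h]
  clear_value B
  have hB : ∀ s v t, t ∈ B s v → t = v ∨ (t ≠ s ∧ G.Adj v t ∧ G.Adj v s) := by
    intro s v t ht
    rw [hBm] at ht
    rcases ht with h | ⟨h1, h2, h3⟩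
    · exact Or.inl h
    · exact Or.inr ⟨h2, hRA _ _ h3, hRA _ _ h1⟩
  have hCA : ∀ s t, t ∈ CN s → t ≠ s ∧ (G.Adj s t ∨ ∃ v, G.Adj s v ∧ G.Adj v t) := by
    intro s t ht
    rw [hCN] at ht
    refine ⟨ht.1, ht.2.imp id ?_⟩
    rintro ⟨v, h1, h2⟩
    exact ⟨v, (hRA _ _ h1).symm, hRA _ _ h2⟩
  have hC2 : ∀ s h v, (∀ t, G.Adj s t ↔ t = h ∨ t = v) → ∀ t, t ∈ CN s →
      t ≠ s ∧ (t = h ∨ G.Adj h t ∨ t ∈ B s v) := by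
    intro s h v hs t ht
    rw [hCN] at ht
    refine ⟨ht.1, ?_⟩
    rcases ht.2 with h1 | ⟨a, h1, h2⟩
    · rw [hs] at h1
      rcases h1 with h1 | h1
      · exact Or.inl h1
      · exact Or.inr (Or.inr ((hBm _ _ _).2 (Or.inl h1)))
    · rcases (hs a).1 (hRA _ _ h1).symm with rfl | rfl
      · exact Or.inr (Or.inl (hRA _ _ h2))
      · exact Or.inr (Or.inr ((hBm _ _ _).2 (Or.inr ⟨h1, ht.1, h2⟩)))
  -- generic facts about the special 2-vertices
  have hBle : ∀ s v a b, (∀ t, G.Adj v t ↔ t = a ∨ t = b) → s ≠ a → (B s v).card ≤ 2 := by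
    intro s v a b hv hsa
    refine (Finset.card_le_card (t := {v, a}) ?_).trans Finset.card_le_two
    intro t ht
    have := hB _ _ _ ht
    simp only [hv] at this
    clear * - this hsa
    simp; grind
  simp only [List.mem_cons, List.not_mem_nil, or_false, not_or] at w1n w2n z1n z2n
  have nd := nodup
  simp only [List.nodup_cons, List.mem_cons, List.not_mem_nil, or_false, not_or] at nd
  have hzb : ∀ s v, z ∈ B s v → v ∈ [z, x, z1, z2] := by
    intro s v hz
    rcases hB _ _ _ hz with h | ⟨_, h, _⟩
    · simp [h]
    · have := (Nz v).1 h.symm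
      clear * - this
      simp; tauto
  have hxb : ∀ s v, s ≠ x → s ≠ w → x ∈ B s v → v ∈ [x, y, z] := by
    intro s v h1 h2 hz
    rcases hB _ _ _ hz with h | ⟨_, h, h'⟩
    · simp [h]
    · have h3 := (Nx v).1 h.symm
      rcases h3 with rfl | rfl | rfl
      · simp
      · simp
      · rw [Nu] at h'; exact absurd h' (by simp [h1, h2])
  have hvz : ∀ s v, (∀ t, G.Adj s t ↔ t = w ∨ t = v) → s ≠ x → v = z → s = z1 ∨ s = z2 := by
    intro s v hs hsx e
    have : G.Adj z s := ((hs z).2 (Or.inr e.symm)).symm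
    rw [Nz] at this; exact this.resolve_left hsx
  have hwz : ∀ s v a b c, (∀ t, G.Adj s t ↔ t = w ∨ t = v) →
      (∀ t, G.Adj a t ↔ t = z ∨ t = b) → (∀ t, G.Adj z t ↔ t = x ∨ t = a ∨ t = c) → s = a →
      B s v ⊆ {z, x, c} ∧ b = w := by
    intro s v a b c hs ha hz e
    subst e
    have hv : v = z := by
      have := (hs z).1 ((ha z).2 (Or.inl rfl))
      rcases this with h | h
      · exact absurd h nd.2.2.1.2
      · exact h.symm
    refine ⟨?_, ?_⟩
    · intro t ht
      have := hB _ _ _ ht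
      rw [hv, hz] at this
      clear * - this
      simp; grind
    · have := (ha w).1 ((hs w).2 (Or.inl rfl))
      rcases this with h | h
      · exact absurd h.symm nd.2.2.1.2
      · exact h.symm
  have cfg : Cfg CN x y z u w w1 w2 z1 z2 y1 y2 v1 v2 t1 t2 (B w1 v1) (B w2 v2) (B z1 t1)
      (B z2 t2) := by
    have Nzs : ∀ t, G.Adj z t ↔ t = x ∨ t = z2 ∨ t = z1 := by
      intro t; rw [Nz, or_comm (a := t = z1)]
    constructor
    · intro a b h
      rw [hCN] at h ⊢
      refine ⟨h.1.symm, h.2.imp (fun h => h.symm) ?_⟩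
      rintro ⟨v, h1, h2⟩; exact ⟨v, h2, h1⟩
    · intro a h; rw [hCN] at h; exact h.1 rfl
    · exact nodup
    · exact w12
    · exact z12
    · simp only [List.mem_cons, List.not_mem_nil, or_false, not_or]; exact w1n
    · simp only [List.mem_cons, List.not_mem_nil, or_false, not_or]; exact w2n
    · simp only [List.mem_cons, List.not_mem_nil, or_false, not_or]; exact z1n
    · simp only [List.mem_cons, List.not_mem_nil, or_false, not_or]; exact z2n
    · intro t ht
      have := hCA _ _ ht
      clear * - this Nu Nx Nw
      simp; grind
    · intro t ht
      have := hCA _ _ ht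
      clear * - this Nu Nx Ny Nz
      simp; grind
    · intro t ht
      have := hCA _ _ ht
      clear * - this Nu Nw Nw1 Nw2
      simp; grind
    · intro t ht
      have := hC2 _ _ _ Nw1 t ht
      clear * - this Nw
      simp; grind
    · intro t ht
      have := hC2 _ _ _ Nw2 t ht
      clear * - this Nw
      simp; grind
    · intro t ht
      have := hCA _ _ ht
      clear * - this Nz Nx Nz1 Nz2
      simp; grind
    · intro t ht
      have := hC2 _ _ _ Nz1 t ht
      clear * - this Nz
      simp; grind
    · intro t ht
      have := hC2 _ _ _ Nz2 t ht
      clear * - this Nz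
      simp; grind
    · rw [hCN]; exact ⟨(Ne.symm nd.1.2.1), Or.inl ((Nx z).2 (by simp))⟩
    · rw [hCN]; exact ⟨z1n.1, Or.inr ⟨z, hRz _ ((Nz x).2 (by simp)), hRz _ ((Nz z1).2 (by simp))⟩⟩
    · rw [hCN]; exact ⟨z2n.1, Or.inr ⟨z, hRz _ ((Nz x).2 (by simp)), hRz _ ((Nz z2).2 (by simp))⟩⟩
    · rw [hCN]; exact ⟨z1n.2.2.1, Or.inl ((Nz z1).2 (by simp))⟩
    · rw [hCN]; exact ⟨z2n.2.2.1, Or.inl ((Nz z2).2 (by simp))⟩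
    · rw [hCN]; exact ⟨z12.symm, Or.inr ⟨z, hRz _ ((Nz z1).2 (by simp)), hRz _ ((Nz z2).2 (by simp))⟩⟩
    · exact hBc _ _
    · exact hBc _ _
    · exact hBc _ _
    · exact hBc _ _
    · rintro rfl; exact hBle _ _ _ _ Nz1 w1n.2.2.1
    · rintro rfl; exact hBle _ _ _ _ Nz2 w1n.2.2.1
    · rintro rfl; exact hBle _ _ _ _ Nz1 w2n.2.2.1
    · rintro rfl; exact hBle _ _ _ _ Nz2 w2n.2.2.1
    · exact hvz _ _ Nw1 w1n.1
    · exact hvz _ _ Nw2 w2n.1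
    · exact hzb _ _
    · exact hzb _ _
    · exact hxb _ _ w1n.1 w1n.2.2.2.2
    · exact hxb _ _ w2n.1 w2n.2.2.2.2
    · exact hwz _ _ _ _ _ Nw1 Nz1 Nz
    · exact hwz _ _ _ _ _ Nw1 Nz2 Nzs
    · exact hwz _ _ _ _ _ Nw2 Nz1 Nz
    · exact hwz _ _ _ _ _ Nw2 Nz2 Nzs
  refine cfg.false (L := L) (φ := φ) ?_ hL ⟨hl, ?_⟩
  · intro ψ hψ
    apply hLn
    refine finish_col G L' R hR1 hR2 ψ (fun v => hLs v (hψ.1 v (by simp))) ?_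
    intro a b hne h
    exact hψ.2 a (by simp) b (by simp) ((hCN _ _).2 ⟨hne, h⟩)
  · intro a ha b hb hab e
    rw [hCN] at hab
    rcases hab.2 with h | ⟨v, h1, h2⟩
    · exact hp a ha b hb h e
    · refine hab.1 (hi v ?_ ?_ e.symm)
      · exact Finset.mem_coe.2 (Finset.mem_sdiff.2 ⟨h2, hb⟩)
      · exact Finset.mem_coe.2 (Finset.mem_sdiff.2 ⟨h1, ha⟩)

lemma nb3 {V : Type*} [Fintype V] {S : Set V} (h : S.ncard = 3) {a b c : V} (ha : a ∈ S)
    (hb : b ∈ S) (hc : c ∈ S) (h1 : a ≠ b) (h2 : a ≠ c) (h3 : b ≠ c) (t : V) :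
    t ∈ S ↔ t = a ∨ t = b ∨ t = c := by
  obtain ⟨p, q, r, _, _, _, rfl⟩ := Set.ncard_eq_three.mp h
  simp at ha hb hc ⊢; grind

lemma nb3' {V : Type*} [Fintype V] {S : Set V} (h : S.ncard = 3) {a : V} (ha : a ∈ S) :
    ∃ b c, b ≠ c ∧ a ≠ b ∧ a ≠ c ∧ ∀ t, t ∈ S ↔ t = a ∨ t = b ∨ t = c := by
  obtain ⟨p, q, r, h1, h2, h3, rfl⟩ := Set.ncard_eq_three.mp h
  simp at ha
  rcases ha with rfl | rfl | rfl
  · exact ⟨q, r, by grind⟩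
  · exact ⟨p, r, by grind⟩
  · exact ⟨p, q, by grind⟩

lemma nb2 {V : Type*} [Fintype V] {S : Set V} (h : S.ncard = 2) {a : V} (ha : a ∈ S) :
    ∃ b, ∀ t, t ∈ S ↔ t = a ∨ t = b := by
  obtain ⟨p, q, h1, rfl⟩ := Set.ncard_eq_two.mp h
  simp at ha
  rcases ha with rfl | rfl
  · exact ⟨q, by grind⟩
  · exact ⟨p, by grind⟩

theorem min_counterexample_no_W1_W2_W3_vertex {V : Type*} [Fintype V]
    (G : SimpleGraph V) (hmad : MadLT G (18 / 7)) (hG : ¬ Ch3dLE G 6)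
    (hmin : ProperSubgraphsCh3dLE G 6) :
    ¬ ∃ x y z w : V, (G.neighborSet x).ncard = 3 ∧
      G.Adj x y ∧ Wmem G 1 y ∧
      G.Adj x z ∧ Wmem G 2 z ∧
      WeakAdj G x w ∧ Wmem G 3 w := by

  rintro ⟨x, y, z, w, hx, hxy, ⟨hy3, hy1⟩, hxz, ⟨hz3, hz2⟩, ⟨hxw, u, hxu, hwu, hu2⟩, hw3, hww⟩
  have hDw : {t | G.Adj w t ∧ (G.neighborSet t).ncard = 2} = G.neighborSet w := by
    apply Set.eq_of_subset_of_ncard_le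
    · intro t ht; exact ht.1
    · omega
    · exact Set.toFinite _
  have hwd : ∀ t, G.Adj w t → (G.neighborSet t).ncard = 2 := by
    intro t ht
    have : t ∈ G.neighborSet w := ht
    rw [← hDw] at this
    exact this.2
  have hyz : y ≠ z := by rintro rfl; omega
  have hyu : y ≠ u := by rintro rfl; omega
  have hzu : z ≠ u := by rintro rfl; omega
  have hxu' : x ≠ u := by rintro rfl; omega
  have hwu' : w ≠ u := by rintro rfl; omega
  have hyw : y ≠ w := by rintro rfl; have := hwd x hxy.symm; omega
  have hzw : z ≠ w := by rintro rfl; have := hwd x hxz.symm; omega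
  have Nx := nb3 hx (a := y) (b := z) (c := u) hxy hxz hxu hyz hyu hzu
  obtain ⟨y1, y2, -, -, -, Ny⟩ := nb3' hy3 (a := x) hxy.symm
  obtain ⟨w1, w2, w12, huw1, huw2, Nw⟩ := nb3' hw3 (a := u) hwu
  obtain ⟨z1, z2, z12, hzz⟩ := Set.ncard_eq_two.mp hz2
  have hz1 : G.Adj z z1 ∧ (G.neighborSet z1).ncard = 2 := by
    have : z1 ∈ {t | G.Adj z t ∧ (G.neighborSet t).ncard = 2} := by rw [hzz]; simp
    exact this
  have hz2' : G.Adj z z2 ∧ (G.neighborSet z2).ncard = 2 := by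
    have : z2 ∈ {t | G.Adj z t ∧ (G.neighborSet t).ncard = 2} := by rw [hzz]; simp
    exact this
  have hxz1 : x ≠ z1 := by rintro rfl; omega
  have hxz2 : x ≠ z2 := by rintro rfl; omega
  have Nz := nb3 hz3 (a := x) (b := z1) (c := z2) hxz.symm hz1.1 hz2'.1 hxz1 hxz2 z12
  have hw1 : G.Adj w w1 := (Nw w1).2 (by simp)
  have hw2 : G.Adj w w2 := (Nw w2).2 (by simp)
  have dw1 := hwd _ hw1
  have dw2 := hwd _ hw2
  obtain ⟨v1, Nw1⟩ := nb2 dw1 (a := w) hw1.symm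
  obtain ⟨v2, Nw2⟩ := nb2 dw2 (a := w) hw2.symm
  obtain ⟨t1, Nz1⟩ := nb2 hz1.2 (a := z) hz1.1.symm
  obtain ⟨t2, Nz2⟩ := nb2 hz2'.2 (a := z) hz2'.1.symm
  have Nu : ∀ t, G.Adj u t ↔ t = x ∨ t = w := by
    obtain ⟨w', hw'⟩ := nb2 hu2 (a := x) hxu.symm
    have := (hw' w).1 hwu.symm
    rcases this with h | h
    · exact absurd h.symm hxw
    · subst h; exact hw'
  have hzu' : ¬ G.Adj z u := by
    intro h
    rcases (Nu z).1 h.symm with h | h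
    · exact hxz.ne' h
    · exact hzw h
  have hxy' := hxy.ne
  have hxz' := hxz.ne
  have d : ∀ a, (G.neighborSet a).ncard = 2 → a ≠ x ∧ a ≠ y ∧ a ≠ z ∧ a ≠ w := by
    intro a ha
    refine ⟨?_, ?_, ?_, ?_⟩ <;> rintro rfl <;> omega
  have e1 := d _ dw1
  have e2 := d _ dw2
  have e3 := d _ hz1.2
  have e4 := d _ hz2'.2
  have e5 : z1 ≠ u := by rintro rfl; exact hzu' hz1.1
  have e6 : z2 ≠ u := by rintro rfl; exact hzu' hz2'.1
  refine build_cfg G hG hmin (x := x) (y := y) (z := z) (u := u) (w := w) (w1 := w1) (w2 := w2)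
    (z1 := z1) (z2 := z2) ?_ w12 z12 ?_ ?_ ?_ ?_ Nx Ny Nz Nu Nw Nw1 Nw2 Nz1 Nz2
  · simp only [List.nodup_cons, List.mem_cons, List.not_mem_nil, or_false, not_or]
    refine ⟨⟨hxy', hxz', hxu', hxw⟩, ⟨hyz, hyu, hyw⟩, ⟨hzu, hzw⟩, hwu'.symm, ?_⟩
    simp
  · simp; exact ⟨e1.1, e1.2.1, e1.2.2.1, huw1.symm, e1.2.2.2⟩
  · simp; exact ⟨e2.1, e2.2.1, e2.2.2.1, huw2.symm, e2.2.2.2⟩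
  · simp; exact ⟨e3.1, e3.2.1, e3.2.2.1, e5, e3.2.2.2⟩
  · simp; exact ⟨e4.1, e4.2.1, e4.2.2.1, e6, e4.2.2.2⟩
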